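/- Let 𝔅 be nonsingular, L ∈ ℝ^{k×l}, x ∈ ℝⁿ, y ∈ ℝᵐ, z ∈ ℝᵖ, and let Ψ, χ be positive real numbers. Then ‖L·𝔅^{-1}·[Ψ·𝒢, −χ·I_l]‖₂ = ‖L·𝔅^{-1}·(Ψ²·𝒥 + χ²·I_l)·(𝔅^{-1})ᵀ·Lᵀ‖₂^{1/2}, where 𝒥 = [[(‖x‖₂² + ‖y‖₂²)·I_n, x·yᵀ, 0],[y·xᵀ, (‖x‖₂² + ‖y‖₂² + ‖z‖₂²)·I_m, y·zᵀ],[0, z·yᵀ, (‖y‖₂² + ‖z‖₂²)·I_p]]. -/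

import Mathlib

open Matrix Filter Topology

noncomputable section

/-- Index type for block vectors of sizes `n, m, p` (the paper's `l = n + m + p`). -/
abbrev Idx (n m p : ℕ) := Fin n ⊕ (Fin m ⊕ Fin p)

/-- Index type for the stacked vector `[vec A; vec B; vec C; vec D; vec E]`
(the paper's `s = n² + nm + mp + m² + p²`). -/
abbrev GIdx (n m p : ℕ) :=
  (Fin n × Fin n) ⊕ ((Fin n × Fin m) ⊕ ((Fin m × Fin p) ⊕ ((Fin m × Fin m) ⊕ (Fin p × Fin p))))

/-- Column-stacking vectorization of a `q × r` matrix: `vecC X (j, i) = X i j`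
(index = (column, row)). -/
def vecC {q r : ℕ} (X : Matrix (Fin q) (Fin r) ℝ) : Fin r × Fin q → ℝ := fun c => X c.2 c.1

/-- The double saddle point block matrix `[[A, Bᵀ, 0], [B, -D, Cᵀ], [0, C, E]]`. -/
def dsp {n m p : ℕ} (A : Matrix (Fin n) (Fin n) ℝ) (B : Matrix (Fin m) (Fin n) ℝ)
    (C : Matrix (Fin p) (Fin m) ℝ) (D : Matrix (Fin m) (Fin m) ℝ)
    (E : Matrix (Fin p) (Fin p) ℝ) : Matrix (Idx n m p) (Idx n m p) ℝ :=
  Matrix.of fun i j =>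
    match i, j with
    | Sum.inl i, Sum.inl j => A i j
    | Sum.inl i, Sum.inr (Sum.inl j) => Bᵀ i j
    | Sum.inl _, Sum.inr (Sum.inr _) => 0
    | Sum.inr (Sum.inl i), Sum.inl j => B i j
    | Sum.inr (Sum.inl i), Sum.inr (Sum.inl j) => -D i j
    | Sum.inr (Sum.inl i), Sum.inr (Sum.inr j) => Cᵀ i j
    | Sum.inr (Sum.inr _), Sum.inl _ => 0
    | Sum.inr (Sum.inr i), Sum.inr (Sum.inl j) => C i j
    | Sum.inr (Sum.inr i), Sum.inr (Sum.inr j) => E i j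

/-- The matrix `𝒢 = [[xᵀ⊗Iₙ, Iₙ⊗yᵀ, 0, 0, 0], [0, xᵀ⊗Iₘ, Iₘ⊗zᵀ, -(yᵀ⊗Iₘ), 0],
[0, 0, yᵀ⊗Iₚ, 0, zᵀ⊗Iₚ]] ∈ ℝ^{l×s}`, written entrywise with respect to the
column-stacking indices (so that `𝒢 ·ᵥ [vec ΔA; vec ΔB; vec ΔC; vec ΔD; vec ΔE]`
is exactly the action of the Kronecker-product block matrix of the paper). -/
def calG {n m p : ℕ} (x : Fin n → ℝ) (y : Fin m → ℝ) (z : Fin p → ℝ) :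
    Matrix (Idx n m p) (GIdx n m p) ℝ :=
  Matrix.of fun i c =>
    match i, c with
    | Sum.inl i, Sum.inl (j, i') => x j * (if i = i' then 1 else 0)
    | Sum.inl i, Sum.inr (Sum.inl (j, i')) => (if i = j then 1 else 0) * y i'
    | Sum.inl _, Sum.inr (Sum.inr (Sum.inl _)) => 0
    | Sum.inl _, Sum.inr (Sum.inr (Sum.inr (Sum.inl _))) => 0
    | Sum.inl _, Sum.inr (Sum.inr (Sum.inr (Sum.inr _))) => 0
    | Sum.inr (Sum.inl _), Sum.inl _ => 0
    | Sum.inr (Sum.inl i), Sum.inr (Sum.inl (j, i')) => x j * (if i = i' then 1 else 0)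
    | Sum.inr (Sum.inl i), Sum.inr (Sum.inr (Sum.inl (j, i'))) => (if i = j then 1 else 0) * z i'
    | Sum.inr (Sum.inl i), Sum.inr (Sum.inr (Sum.inr (Sum.inl (j, i')))) =>
        -(y j * (if i = i' then 1 else 0))
    | Sum.inr (Sum.inl _), Sum.inr (Sum.inr (Sum.inr (Sum.inr _))) => 0
    | Sum.inr (Sum.inr _), Sum.inl _ => 0
    | Sum.inr (Sum.inr _), Sum.inr (Sum.inl _) => 0
    | Sum.inr (Sum.inr i), Sum.inr (Sum.inr (Sum.inl (j, i'))) => y j * (if i = i' then 1 else 0)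
    | Sum.inr (Sum.inr _), Sum.inr (Sum.inr (Sum.inr (Sum.inl _))) => 0
    | Sum.inr (Sum.inr i), Sum.inr (Sum.inr (Sum.inr (Sum.inr (j, i')))) =>
        z j * (if i = i' then 1 else 0)

/-- The stacked vector `[vec A; vec B; vec C; vec D; vec E]`. -/
def vecG {n m p : ℕ} (A : Matrix (Fin n) (Fin n) ℝ) (B : Matrix (Fin m) (Fin n) ℝ)
    (C : Matrix (Fin p) (Fin m) ℝ) (D : Matrix (Fin m) (Fin m) ℝ)
    (E : Matrix (Fin p) (Fin p) ℝ) : GIdx n m p → ℝ :=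
  Sum.elim (vecC A) (Sum.elim (vecC B) (Sum.elim (vecC C) (Sum.elim (vecC D) (vecC E))))

/-- Euclidean norm of a vector. -/
def euclNorm {ι : Type*} [Fintype ι] (v : ι → ℝ) : ℝ := Real.sqrt (∑ i, v i ^ 2)

/-- Spectral norm (largest singular value = induced 2-norm) of a real matrix. -/
def specNorm {a b : Type*} [Fintype a] [Fintype b] (M : Matrix a b ℝ) : ℝ :=
  sSup {r : ℝ | ∃ v : b → ℝ, euclNorm v = 1 ∧ r = euclNorm (M.mulVec v)}

/-- Max-norm (`‖·‖_∞`) of a vector. -/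
def infNormV {ι : Type*} [Fintype ι] (v : ι → ℝ) : ℝ := ⨆ i, |v i|

/-- Induced ∞-norm of a matrix: the maximum absolute row sum. -/
def infNormM {a b : Type*} [Fintype a] [Fintype b] (M : Matrix a b ℝ) : ℝ :=
  ⨆ i, ∑ j, |M i j|

/-- Horizontal (block-column) concatenation `[M, N]`. -/
def hcat {a b c : Type*} (M : Matrix a b ℝ) (N : Matrix a c ℝ) : Matrix a (b ⊕ c) ℝ :=
  Matrix.of fun i => Sum.elim (M i) (N i)

/-- Entrywise absolute value of a matrix. -/
def absM {a b : Type*} (M : Matrix a b ℝ) : Matrix a b ℝ := Matrix.of fun i j => |M i j|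

/-- Entrywise absolute value of a vector. -/
def absV {ι : Type*} (v : ι → ℝ) : ι → ℝ := fun i => |v i|

/-- The matrix `𝒥 = [[(‖x‖₂²+‖y‖₂²)Iₙ, xyᵀ, 0], [yxᵀ, (‖x‖₂²+‖y‖₂²+‖z‖₂²)Iₘ, yzᵀ],
[0, zyᵀ, (‖y‖₂²+‖z‖₂²)Iₚ]]`. -/
def calJ {n m p : ℕ} (x : Fin n → ℝ) (y : Fin m → ℝ) (z : Fin p → ℝ) :
    Matrix (Idx n m p) (Idx n m p) ℝ :=
  Matrix.of fun i j =>
    match i, j with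
    | Sum.inl i, Sum.inl j => (euclNorm x ^ 2 + euclNorm y ^ 2) * (if i = j then 1 else 0)
    | Sum.inl i, Sum.inr (Sum.inl j) => x i * y j
    | Sum.inl _, Sum.inr (Sum.inr _) => 0
    | Sum.inr (Sum.inl i), Sum.inl j => y i * x j
    | Sum.inr (Sum.inl i), Sum.inr (Sum.inl j) =>
        (euclNorm x ^ 2 + euclNorm y ^ 2 + euclNorm z ^ 2) * (if i = j then 1 else 0)
    | Sum.inr (Sum.inl i), Sum.inr (Sum.inr j) => y i * z j
    | Sum.inr (Sum.inr _), Sum.inl _ => 0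
    | Sum.inr (Sum.inr i), Sum.inr (Sum.inl j) => z i * y j
    | Sum.inr (Sum.inr i), Sum.inr (Sum.inr j) =>
        (euclNorm y ^ 2 + euclNorm z ^ 2) * (if i = j then 1 else 0)

/-- The scaled perturbation vector
`[vec(Ψ_A‡⊙ΔA); vec(Ψ_B‡⊙ΔB); vec(Ψ_C‡⊙ΔC); vec(Ψ_D‡⊙ΔD); vec(Ψ_E‡⊙ΔE); χ‡⊙Δb]`
(for data with all entries nonzero, `v‡` is the entrywise reciprocal). -/
def scaledPert {n m p : ℕ} (ΨA : Matrix (Fin n) (Fin n) ℝ) (ΨB : Matrix (Fin m) (Fin n) ℝ)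
    (ΨC : Matrix (Fin p) (Fin m) ℝ) (ΨD : Matrix (Fin m) (Fin m) ℝ)
    (ΨE : Matrix (Fin p) (Fin p) ℝ) (χ : Idx n m p → ℝ)
    (ΔA : Matrix (Fin n) (Fin n) ℝ) (ΔB : Matrix (Fin m) (Fin n) ℝ)
    (ΔC : Matrix (Fin p) (Fin m) ℝ) (ΔD : Matrix (Fin m) (Fin m) ℝ)
    (ΔE : Matrix (Fin p) (Fin p) ℝ) (Δb : Idx n m p → ℝ) : GIdx n m p ⊕ Idx n m p → ℝ :=
  Sum.elim (fun c => (vecG ΨA ΨB ΨC ΨD ΨE c)⁻¹ * vecG ΔA ΔB ΔC ΔD ΔE c)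
    (fun i => (χ i)⁻¹ * Δb i)

/-- The vector `ℋ = [|A||x| + |B|ᵀ|y|; |B||x| + |D||y| + |C|ᵀ|z|; |C||y| + |E||z|]`. -/
def calH {n m p : ℕ} (A : Matrix (Fin n) (Fin n) ℝ) (B : Matrix (Fin m) (Fin n) ℝ)
    (C : Matrix (Fin p) (Fin m) ℝ) (D : Matrix (Fin m) (Fin m) ℝ)
    (E : Matrix (Fin p) (Fin p) ℝ) (x : Fin n → ℝ) (y : Fin m → ℝ) (z : Fin p → ℝ) :
    Idx n m p → ℝ :=
  Sum.elim ((absM A).mulVec (absV x) + (absM B)ᵀ.mulVec (absV y))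
    (Sum.elim
      ((absM B).mulVec (absV x) + (absM D).mulVec (absV y) + (absM C)ᵀ.mulVec (absV z))
      ((absM C).mulVec (absV y) + (absM E).mulVec (absV z)))

/-- Index type of the structured (generating-vector) parameter space
`[a; vec B; vec C; d; e]`. -/
abbrev SIdx (n m p s₁ r q : ℕ) :=
  Fin s₁ ⊕ (((Fin n × Fin m) ⊕ (Fin m × Fin p)) ⊕ (Fin r ⊕ Fin q))

/-- `Φ_S = blkdiag(Φ₁, I_{nm+mp}, Φ₂, Φ₃)`. -/
def PhiS {n m p s₁ r q : ℕ} (Φ₁ : Matrix (Fin n × Fin n) (Fin s₁) ℝ)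
    (Φ₂ : Matrix (Fin m × Fin m) (Fin r) ℝ) (Φ₃ : Matrix (Fin p × Fin p) (Fin q) ℝ) :
    Matrix (GIdx n m p) (SIdx n m p s₁ r q) ℝ :=
  Matrix.of fun i j =>
    match i, j with
    | Sum.inl i, Sum.inl j => Φ₁ i j
    | Sum.inr (Sum.inl i), Sum.inr (Sum.inl (Sum.inl j)) => if i = j then 1 else 0
    | Sum.inr (Sum.inr (Sum.inl i)), Sum.inr (Sum.inl (Sum.inr j)) => if i = j then 1 else 0
    | Sum.inr (Sum.inr (Sum.inr (Sum.inl i))), Sum.inr (Sum.inr (Sum.inl j)) => Φ₂ i j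
    | Sum.inr (Sum.inr (Sum.inr (Sum.inr i))), Sum.inr (Sum.inr (Sum.inr j)) => Φ₃ i j
    | _, _ => 0

/-- The structured scaled perturbation vector
`[ψ_A‡⊙Δa; vec(Ψ_B‡⊙ΔB); vec(Ψ_C‡⊙ΔC); ψ_D‡⊙Δd; ψ_E‡⊙Δe; χ‡⊙Δb]`. -/
def structPert {n m p s₁ r q : ℕ} (ψA : Fin s₁ → ℝ) (ΨB : Matrix (Fin m) (Fin n) ℝ)
    (ΨC : Matrix (Fin p) (Fin m) ℝ) (ψD : Fin r → ℝ) (ψE : Fin q → ℝ) (χ : Idx n m p → ℝ)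
    (Δa : Fin s₁ → ℝ) (ΔB : Matrix (Fin m) (Fin n) ℝ) (ΔC : Matrix (Fin p) (Fin m) ℝ)
    (Δd : Fin r → ℝ) (Δe : Fin q → ℝ) (Δb : Idx n m p → ℝ) :
    SIdx n m p s₁ r q ⊕ Idx n m p → ℝ :=
  Sum.elim
    (Sum.elim (fun j => (ψA j)⁻¹ * Δa j)
      (Sum.elim
        (Sum.elim (fun c => (vecC ΨB c)⁻¹ * vecC ΔB c) (fun c => (vecC ΨC c)⁻¹ * vecC ΔC c))
        (Sum.elim (fun j => (ψD j)⁻¹ * Δd j) (fun j => (ψE j)⁻¹ * Δe j))))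
    (fun i => (χ i)⁻¹ * Δb i)

/-- The EILS augmented matrix `𝔅̂ = [[0, 0, C], [0, J, M], [Cᵀ, Mᵀ, 0]]`
(block sizes `p, n, m`). -/
def eilsAug {n m p : ℕ} (J : Matrix (Fin n) (Fin n) ℝ) (M : Matrix (Fin n) (Fin m) ℝ)
    (C : Matrix (Fin p) (Fin m) ℝ) :
    Matrix (Fin p ⊕ (Fin n ⊕ Fin m)) (Fin p ⊕ (Fin n ⊕ Fin m)) ℝ :=
  Matrix.of fun i j =>
    match i, j with
    | Sum.inl i, Sum.inr (Sum.inr j) => C i j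
    | Sum.inr (Sum.inl i), Sum.inr (Sum.inl j) => J i j
    | Sum.inr (Sum.inl i), Sum.inr (Sum.inr j) => M i j
    | Sum.inr (Sum.inr i), Sum.inl j => Cᵀ i j
    | Sum.inr (Sum.inr i), Sum.inr (Sum.inl j) => Mᵀ i j
    | _, _ => 0

/-- The block permutation matrix `Σ = [[0, Iₙ, 0], [0, 0, Iₘ], [I_p, 0, 0]]`
(block rows of sizes `n, m, p`; block columns of sizes `p, n, m`). -/
def sigmaPerm (n m p : ℕ) : Matrix (Idx n m p) (Fin p ⊕ (Fin n ⊕ Fin m)) ℝ :=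
  Matrix.of fun i j =>
    match i, j with
    | Sum.inl i, Sum.inr (Sum.inl j) => if i = j then 1 else 0
    | Sum.inr (Sum.inl i), Sum.inr (Sum.inr j) => if i = j then 1 else 0
    | Sum.inr (Sum.inr i), Sum.inl j => if i = j then 1 else 0
    | _, _ => 0

/-- The matrix `𝒢̂ = [[yᵀ⊗Iₙ, 0], [Iₘ⊗xᵀ, Iₘ⊗zᵀ], [0, yᵀ⊗I_p]] ∈ ℝ^{l×m(n+p)}`,
written entrywise with respect to column-stacking indices of `[vec(ΔBᵀ); vec(ΔC)]`. -/
def hatG {n m p : ℕ} (x : Fin n → ℝ) (y : Fin m → ℝ) (z : Fin p → ℝ) :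
    Matrix (Idx n m p) ((Fin m × Fin n) ⊕ (Fin m × Fin p)) ℝ :=
  Matrix.of fun i c =>
    match i, c with
    | Sum.inl i, Sum.inl (j, i') => y j * (if i = i' then 1 else 0)
    | Sum.inl _, Sum.inr _ => 0
    | Sum.inr (Sum.inl i), Sum.inl (j, i') => (if i = j then 1 else 0) * x i'
    | Sum.inr (Sum.inl i), Sum.inr (j, i') => (if i = j then 1 else 0) * z i'
    | Sum.inr (Sum.inr _), Sum.inl _ => 0
    | Sum.inr (Sum.inr i), Sum.inr (j, i') => y j * (if i = i' then 1 else 0)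

lemma euclNorm_eq_norm {ι : Type*} [Fintype ι] (v : ι → ℝ) :
    euclNorm v = ‖WithLp.toLp 2 v‖ := by
  simp [euclNorm, EuclideanSpace.norm_eq]

lemma euclNorm_sq {ι : Type*} [Fintype ι] (v : ι → ℝ) : euclNorm v ^ 2 = ∑ i, v i ^ 2 :=
  Real.sq_sqrt (Finset.sum_nonneg fun i _ => sq_nonneg (v i))

open scoped Matrix.Norms.L2Operator in
lemma specNorm_eq_l2_opNorm {a b : Type*} [Fintype a] [Fintype b] [DecidableEq b]
    (M : Matrix a b ℝ) : specNorm M = ‖M‖ := by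
  set f := (toEuclideanLin.trans LinearMap.toContinuousLinearMap) M
  have hMf : ‖M‖ = ‖f‖ := l2_opNorm_def M
  have happ (v : b → ℝ) : ‖f (WithLp.toLp 2 v)‖ = euclNorm (M *ᵥ v) := by
    rw [euclNorm_eq_norm]
    rfl
  rw [hMf, ← f.sSup_sphere_eq_norm, specNorm]
  congr 1
  ext r
  simp only [Set.mem_ofPred_eq, Set.mem_image, mem_sphere_zero_iff_norm]
  constructor
  · rintro ⟨v, hv, rfl⟩
    exact ⟨WithLp.toLp 2 v, by rw [← hv, euclNorm_eq_norm], happ v⟩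
  · rintro ⟨v, hv, rfl⟩
    exact ⟨v.ofLp, by rw [euclNorm_eq_norm]; exact hv, happ v.ofLp⟩

open scoped Matrix.Norms.L2Operator in
lemma specNorm_eq_sqrt_specNorm_mul_transpose {a b : Type*} [Fintype a] [Fintype b]
    (M : Matrix a b ℝ) : specNorm M = Real.sqrt (specNorm (M * Mᵀ)) := by
  classical
  rw [specNorm_eq_l2_opNorm, specNorm_eq_l2_opNorm]
  have h := l2_opNorm_conjTranspose_mul_self (Mᴴ)
  rw [conjTranspose_conjTranspose, l2_opNorm_conjTranspose, conjTranspose_eq_transpose_of_trivial]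
    at h
  rw [h, Real.sqrt_mul_self (norm_nonneg _)]

lemma hcat_mul_transpose {a b c : Type*} [Fintype b] [Fintype c] (M : Matrix a b ℝ)
    (N : Matrix a c ℝ) : hcat M N * (hcat M N)ᵀ = M * Mᵀ + N * Nᵀ := by
  ext i j
  simp [hcat, mul_apply]

lemma calG_mul_transpose {n m p : ℕ} (x : Fin n → ℝ) (y : Fin m → ℝ) (z : Fin p → ℝ) :
    calG x y z * (calG x y z)ᵀ = calJ x y z := by
  ext i j
  rcases i with i | i | i <;> rcases j with j | j | j <;>
    simp only [calG, calJ, mul_apply, transpose_apply, of_apply, Fintype.sum_sum_type,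
      Fintype.sum_prod_type, euclNorm_sq, mul_ite, ite_mul, mul_one, mul_zero, zero_mul, one_mul,
      Finset.sum_ite_eq, Finset.mem_univ, if_true, Finset.sum_const_zero, Finset.sum_ite_irrel,
      ite_self, add_zero, zero_add, neg_mul, mul_neg, neg_ite, neg_neg, neg_zero]
  all_goals first
    | ring1
    | split_ifs <;> simp only [sq, add_zero] <;> ring1

/-- Kronecker-product-free reformulation of the spectral norm. -/
theorem stmt5 {n m p k : ℕ}
    (A : Matrix (Fin n) (Fin n) ℝ) (B : Matrix (Fin m) (Fin n) ℝ) (C : Matrix (Fin p) (Fin m) ℝ)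
    (D : Matrix (Fin m) (Fin m) ℝ) (E : Matrix (Fin p) (Fin p) ℝ)
    (hB : IsUnit (dsp A B C D E).det)
    (L : Matrix (Fin k) (Idx n m p) ℝ)
    (x : Fin n → ℝ) (y : Fin m → ℝ) (z : Fin p → ℝ)
    (Ψ χ : ℝ) (hΨ : 0 < Ψ) (hχ : 0 < χ) :
    specNorm (L * (dsp A B C D E)⁻¹ *
        hcat (Ψ • calG x y z) ((-χ) • (1 : Matrix (Idx n m p) (Idx n m p) ℝ))) =
      Real.sqrt (specNorm (L * (dsp A B C D E)⁻¹ *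
        (Ψ ^ 2 • calJ x y z + χ ^ 2 • (1 : Matrix (Idx n m p) (Idx n m p) ℝ)) *
        ((dsp A B C D E)⁻¹)ᵀ * Lᵀ)) := by
  rw [specNorm_eq_sqrt_specNorm_mul_transpose, transpose_mul, transpose_mul]
  congr 2
  have h : hcat (Ψ • calG x y z) ((-χ) • (1 : Matrix (Idx n m p) (Idx n m p) ℝ)) *
      (hcat (Ψ • calG x y z) ((-χ) • (1 : Matrix (Idx n m p) (Idx n m p) ℝ)))ᵀ =
      Ψ ^ 2 • calJ x y z + χ ^ 2 • (1 : Matrix (Idx n m p) (Idx n m p) ℝ) := by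
    rw [hcat_mul_transpose, ← calG_mul_transpose]
    simp [smul_smul, sq]
  rw [← h]
  simp only [Matrix.mul_assoc]

end
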